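/- Let c > 0 be a real number, let ν ∈ ℂ with Re(ν) > 0, and let N₀ ∈ ℂ. Define N : (0,∞) → ℂ by N(t) = N₀ · ∑_{r=0}^∞ (−1)^r (c t)^{ν r} / Γ(ν r + 1), where (ct)^{νr} is the principal complex power of the positive real number ct. Then for every t > 0, N satisfies the fractional kinetic equation N(t) − N₀ = −c^ν · (1/Γ(ν)) · ∫₀^t (t−s)^{ν−1} N(s) ds, where (t−s)^{ν−1} and c^ν are principal complex powers of positive reals and the integral is over real s ∈ (0,t). -/

import Mathlib

/-- The complex Miller-Ross function `E_{ν,c}(z) = z^ν ∑_{n=0}^∞ (cz)^n / Γ(ν+n+1)`,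
using the principal complex power and the convention `1/Γ(m) = 0` at nonpositive
integers `m` (in Mathlib `Complex.Gamma` vanishes there, and division by `0` is `0`). -/
noncomputable def millerRoss (ν c z : ℂ) : ℂ :=
  z ^ ν * ∑' n : ℕ, (c * z) ^ n / Complex.Gamma (ν + n + 1)

open MeasureTheory Filter Topology in
/-- The kernel of the Riemann–Liouville integral is integrable. -/
theorem intervalIntegrable_sub_cpow {ν : ℂ} (hν : 0 < ν.re) (t : ℝ) :
    IntervalIntegrable (fun s : ℝ => ((t - s : ℝ) : ℂ) ^ (ν - 1)) volume 0 t := by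
  have h : IntervalIntegrable (fun s : ℝ => (s : ℂ) ^ (ν - 1)) volume t 0 :=
    intervalIntegral.intervalIntegrable_cpow' (by simpa using hν)
  simpa using h.comp_sub_left t

open MeasureTheory Filter Topology in
theorem tendsto_betaIntegral_mul_nat_add_one {ν : ℂ} (hν : 0 < ν.re) :
    Tendsto (fun r : ℕ => Complex.betaIntegral (ν * r + 1) ν) atTop (𝓝 0) := by
  have key := intervalIntegral.tendsto_integral_filter_of_dominated_convergence
    (μ := volume) (a := 0) (b := 1) (l := atTop)
    (F := fun (r : ℕ) (x : ℝ) => (x : ℂ) ^ (ν * r + 1 - 1) * (1 - (x : ℂ)) ^ (ν - 1))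
    (f := fun _ => 0) (fun x : ℝ => ‖((1 - x : ℝ) : ℂ) ^ (ν - 1)‖) ?_ ?_
    (intervalIntegrable_sub_cpow hν 1).norm ?_
  · simpa [Complex.betaIntegral] using key
  · exact .of_forall fun r => (by fun_prop : Measurable _).aestronglyMeasurable
  · refine .of_forall fun r => .of_forall fun x hx => ?_
    rw [Set.uIoc_of_le zero_le_one] at hx
    rw [norm_mul, Complex.norm_cpow_eq_rpow_re_of_pos hx.1]
    push_cast
    refine mul_le_of_le_one_left (norm_nonneg _) (Real.rpow_le_one hx.1.le hx.2 ?_)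
    simp only [add_sub_cancel_right, Complex.mul_re, Complex.natCast_re, Complex.natCast_im,
      mul_zero, sub_zero]
    positivity
  · filter_upwards [Measure.ae_ne volume (1 : ℝ)] with x hx1 hx
    rw [Set.uIoc_of_le zero_le_one] at hx
    have hlt : ‖(x : ℂ) ^ ν‖ < 1 := by
      rw [Complex.norm_cpow_eq_rpow_re_of_pos hx.1]
      exact Real.rpow_lt_one hx.1.le (lt_of_le_of_ne hx.2 hx1) hν
    simpa [Complex.cpow_mul_nat] using
      (tendsto_pow_atTop_nhds_zero_of_norm_lt_one hlt).mul_const ((1 - (x : ℂ)) ^ (ν - 1))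

theorem mul_natCast_add_one_re_pos {ν : ℂ} (hν : 0 < ν.re) (r : ℕ) :
    0 < (ν * (r : ℂ) + 1).re := by
  simp only [Complex.add_re, Complex.mul_re, Complex.natCast_re, Complex.natCast_im, mul_zero,
    sub_zero, Complex.one_re]
  positivity

open Filter Topology in
/-- The Mittag-Leffler series converges everywhere. -/
theorem summable_pow_div_Gamma {ν : ℂ} (hν : 0 < ν.re) (z : ℂ) :
    Summable fun r : ℕ => z ^ r / Complex.Gamma (ν * (r : ℂ) + 1) := by
  rcases eq_or_ne z 0 with rfl | hz
  · refine summable_of_ne_finset_zero (s := {0}) fun r hr => ?_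
    rw [Finset.mem_singleton] at hr
    simp [hr]
  have hG (r : ℕ) := Complex.Gamma_ne_zero_of_re_pos (mul_natCast_add_one_re_pos hν r)
  have hGν := Complex.Gamma_ne_zero_of_re_pos hν
  refine summable_of_ratio_test_tendsto_lt_one zero_lt_one
    (.of_forall fun r => div_ne_zero (pow_ne_zero r hz) (hG r)) ?_
  have h := ((tendsto_betaIntegral_mul_nat_add_one hν).const_mul (z / Complex.Gamma ν)).norm
  rw [mul_zero, norm_zero] at h
  refine h.congr fun r => ?_
  rw [← norm_div, Complex.betaIntegral_eq_Gamma_mul_div _ _ (mul_natCast_add_one_re_pos hν r) hν]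
  have hr : ν * (r : ℂ) + 1 + ν = ν * ((r + 1 : ℕ) : ℂ) + 1 := by push_cast; ring
  rw [hr]
  have := hG r
  have := hG (r + 1)
  congr 1
  field_simp
  ring

/-- The Riemann–Liouville kernel integrated against a power function. -/
theorem integral_sub_cpow_mul_cpow {ν μ : ℂ} (hν : 0 < ν.re) (hμ : 0 < (μ + 1).re) {t : ℝ}
    (ht : 0 < t) :
    ∫ s in (0:ℝ)..t, ((t - s : ℝ) : ℂ) ^ (ν - 1) * (s : ℂ) ^ μ =
      (t : ℂ) ^ (μ + ν) * (Complex.Gamma (μ + 1) * Complex.Gamma ν / Complex.Gamma (μ + ν + 1)) := by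
  have h := Complex.betaIntegral_scaled (μ + 1) ν ht
  rw [Complex.betaIntegral_eq_Gamma_mul_div _ _ hμ hν] at h
  simp only [add_sub_cancel_right, add_right_comm μ 1 ν] at h
  rw [← h]
  refine intervalIntegral.integral_congr fun s _ => ?_
  push_cast
  ring

open MeasureTheory Filter Topology in
/-- The Riemann–Liouville kernel may be integrated termwise against the Mittag-Leffler series. -/
theorem hasSum_integral_sub_cpow_mul_pow_div_Gamma {ν : ℂ} (hν : 0 < ν.re) (z : ℂ) {t : ℝ}
    (ht : 0 < t) :
    HasSum
      (fun r : ℕ => ∫ s in (0:ℝ)..t,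
        ((t - s : ℝ) : ℂ) ^ (ν - 1) * ((z * (s : ℂ) ^ ν) ^ r / Complex.Gamma (ν * (r : ℂ) + 1)))
      (∫ s in (0:ℝ)..t, ((t - s : ℝ) : ℂ) ^ (ν - 1) *
        ∑' r : ℕ, (z * (s : ℂ) ^ ν) ^ r / Complex.Gamma (ν * (r : ℂ) + 1)) := by
  have hs := (summable_pow_div_Gamma hν (z * (t : ℂ) ^ ν)).norm
  refine intervalIntegral.hasSum_integral_of_dominated_convergence
    (fun r s => ‖((t - s : ℝ) : ℂ) ^ (ν - 1)‖ *
      ‖(z * (t : ℂ) ^ ν) ^ r / Complex.Gamma (ν * (r : ℂ) + 1)‖)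
    (fun r => (by fun_prop : Measurable _).aestronglyMeasurable) (fun r => .of_forall fun s hs => ?_)
    (.of_forall fun s _ => hs.mul_left _) ?_
    (.of_forall fun s _ => (summable_pow_div_Gamma hν _).hasSum.mul_left _)
  · rw [Set.uIoc_of_le ht.le] at hs
    simp only [norm_mul, norm_div, norm_pow, Complex.norm_cpow_eq_rpow_re_of_pos hs.1,
      Complex.norm_cpow_eq_rpow_re_of_pos ht]
    have := Real.rpow_le_rpow hs.1.le hs.2 hν.le
    have := Real.rpow_nonneg hs.1.le ν.re
    gcongr
  · simp_rw [tsum_mul_left]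
    exact (intervalIntegrable_sub_cpow hν t).norm.mul_const _

open MeasureTheory intervalIntegral in
/-- Theorem 7.1, component form: `N(t) = N₀ ∑_{r=0}^∞ (−1)^r (ct)^{νr}/Γ(νr+1)`
solves the fractional kinetic equation `N(t) − N₀ = −c^ν D_t^{−ν} N(t)`, where
`D_t^{−ν} f(t) = (1/Γ(ν)) ∫₀^t (t−s)^{ν−1} f(s) ds`. -/
theorem fractional_kinetic_solution (c : ℝ) (hc : 0 < c) (ν : ℂ) (hν : 0 < ν.re)
    (N₀ : ℂ) (N : ℝ → ℂ)
    (hN : ∀ t : ℝ, N t =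
      N₀ * ∑' r : ℕ, (-1) ^ r * ((c * t : ℝ) : ℂ) ^ (ν * (r : ℂ)) / Complex.Gamma (ν * (r : ℂ) + 1)) :
    ∀ t : ℝ, 0 < t →
      N t - N₀ =
        -((c : ℂ) ^ ν) *
          ((1 / Complex.Gamma ν) * ∫ s in (0:ℝ)..t, ((t - s : ℝ) : ℂ) ^ (ν - 1) * N s) := by
  intro t ht
  have hterm (s : ℝ) (hs : 0 ≤ s) (r : ℕ) :
      (-1) ^ r * ((c * s : ℝ) : ℂ) ^ (ν * (r : ℂ)) / Complex.Gamma (ν * (r : ℂ) + 1) =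
        (-(c : ℂ) ^ ν * (s : ℂ) ^ ν) ^ r / Complex.Gamma (ν * (r : ℂ) + 1) := by
    rw [Complex.cpow_mul_nat, Complex.ofReal_mul, Complex.mul_cpow_ofReal_nonneg hc.le hs, ← mul_pow]
    ring
  have hN' (s : ℝ) (hs : 0 ≤ s) : N s = N₀ * ∑' r : ℕ,
      (-(c : ℂ) ^ ν * (s : ℂ) ^ ν) ^ r / Complex.Gamma (ν * (r : ℂ) + 1) := by
    rw [hN, tsum_congr (hterm s hs)]
  have hGν := Complex.Gamma_ne_zero_of_re_pos hν
  have hint : ∫ s in (0:ℝ)..t, ((t - s : ℝ) : ℂ) ^ (ν - 1) * N s =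
      N₀ * ∫ s in (0:ℝ)..t, ((t - s : ℝ) : ℂ) ^ (ν - 1) * ∑' r : ℕ,
        (-(c : ℂ) ^ ν * (s : ℂ) ^ ν) ^ r / Complex.Gamma (ν * (r : ℂ) + 1) := by
    rw [← intervalIntegral.integral_const_mul]
    refine intervalIntegral.integral_congr fun s hs => ?_
    rw [Set.uIcc_of_le ht.le] at hs
    simp only [hN' s hs.1]
    ring
  have hstep (r : ℕ) :
      (-(c : ℂ) ^ ν * (t : ℂ) ^ ν) ^ (r + 1) / Complex.Gamma (ν * ((r + 1 : ℕ) : ℂ) + 1) =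
        -(c : ℂ) ^ ν * (1 / Complex.Gamma ν) * ∫ s in (0:ℝ)..t, ((t - s : ℝ) : ℂ) ^ (ν - 1) *
          ((-(c : ℂ) ^ ν * (s : ℂ) ^ ν) ^ r / Complex.Gamma (ν * (r : ℂ) + 1)) := by
    have hG := Complex.Gamma_ne_zero_of_re_pos (mul_natCast_add_one_re_pos hν r)
    have hcongr : ∀ s : ℝ, ((t - s : ℝ) : ℂ) ^ (ν - 1) *
          ((-(c : ℂ) ^ ν * (s : ℂ) ^ ν) ^ r / Complex.Gamma (ν * (r : ℂ) + 1)) =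
        (-(c : ℂ) ^ ν) ^ r / Complex.Gamma (ν * (r : ℂ) + 1) *
          (((t - s : ℝ) : ℂ) ^ (ν - 1) * (s : ℂ) ^ (ν * (r : ℂ))) := fun s => by
      rw [Complex.cpow_mul_nat, mul_pow]
      ring
    simp_rw [hcongr]
    rw [intervalIntegral.integral_const_mul,
      integral_sub_cpow_mul_cpow hν (mul_natCast_add_one_re_pos hν r) ht,
      show ν * (r : ℂ) + ν = ν * ((r + 1 : ℕ) : ℂ) by push_cast; ring, Complex.cpow_mul_nat]
    field_simp
    ring
  rw [hint, hN' t ht.le, (summable_pow_div_Gamma hν _).tsum_eq_zero_add, tsum_congr hstep,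
    tsum_mul_left, (hasSum_integral_sub_cpow_mul_pow_div_Gamma hν _ ht).tsum_eq]
  simp only [pow_zero, Nat.cast_zero, mul_zero, zero_add, Complex.Gamma_one, div_one]
  ring
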